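/- Theorem 2: the term rewriting system ⇒ on SAND attack trees (modulo commutativity of OR and AND) is strongly terminating and confluent: there is no infinite rewrite sequence, and whenever t rewrites in zero or more steps to both t1 and t2, there exists a term t3 such that both t1 and t2 rewrite in zero or more steps to t3. -/

import Mathlib

/-!
Formalization of "Attack Trees with Sequential Conjunction".

Source-sink graphs over a set `B` of basic actions: a vertex type `V`,
a multiset of labeled edges, a source `s` and a sink `z` with `s ≠ z`.
-/

structure SSG (B : Type) : Type 1 where
  V : Type
  deq : DecidableEq V
  E : Multiset (V × B × V)
  s : V
  z : V
  ne : s ≠ z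

namespace SSG

variable {B : Type}

/-- The graph with a single edge labeled `b`. -/
def single (b : B) : SSG B where
  V := Bool
  deq := inferInstance
  E := {(false, b, true)}
  s := false
  z := true
  ne := Bool.false_ne_true

/-- In the sequential composition, the sink of the first graph is identified with
the source of the second graph. -/
def seqEmbed (G G' : SSG B) (v : G.V) : ({u : G.V // u ≠ G.z} ⊕ G'.V) :=
  haveI := G.deq
  if h : v = G.z then Sum.inr G'.s else Sum.inl ⟨v, h⟩

/-- Sequential composition `G ⋅ G'` of source-sink graphs: the disjoint union in which
the sink of `G` is identified with the source of `G'`. -/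
def seq (G G' : SSG B) : SSG B where
  V := {u : G.V // u ≠ G.z} ⊕ G'.V
  deq := by haveI := G.deq; haveI := G'.deq; infer_instance
  E := G.E.map (fun e => (G.seqEmbed G' e.1, e.2.1, G.seqEmbed G' e.2.2)) +
       G'.E.map (fun e => (Sum.inr e.1, e.2.1, Sum.inr e.2.2))
  s := Sum.inl ⟨G.s, G.ne⟩
  z := Sum.inr G'.z
  ne := by simp

/-- In the parallel composition, the two sources are identified and the two sinks
are identified. -/
def parEmbed (G G' : SSG B) (v : G.V) : ({u : G.V // u ≠ G.s ∧ u ≠ G.z} ⊕ G'.V) :=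
  haveI := G.deq
  if hs : v = G.s then Sum.inr G'.s
  else if hz : v = G.z then Sum.inr G'.z
  else Sum.inl ⟨v, hs, hz⟩

/-- Parallel composition `G ∥ G'` of source-sink graphs: the disjoint union in which
the two sources are identified and the two sinks are identified. -/
def par (G G' : SSG B) : SSG B where
  V := {u : G.V // u ≠ G.s ∧ u ≠ G.z} ⊕ G'.V
  deq := by haveI := G.deq; haveI := G'.deq; infer_instance
  E := G.E.map (fun e => (G.parEmbed G' e.1, e.2.1, G.parEmbed G' e.2.2)) +
       G'.E.map (fun e => (Sum.inr e.1, e.2.1, Sum.inr e.2.2))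
  s := Sum.inr G'.s
  z := Sum.inr G'.z
  ne := fun h => G'.ne (Sum.inr_injective h)

/-- Two source-sink graphs are equal (isomorphic) if there is a bijection between their
vertex sets that preserves the labeled edges (and hence source and sink). -/
def Iso (G G' : SSG B) : Prop :=
  ∃ f : G.V ≃ G'.V,
    G.E.map (fun e => (f e.1, e.2.1, f e.2.2)) = G'.E ∧ f G.s = G'.s ∧ f G.z = G'.z

/-- Directed adjacency: there is an edge from `u` to `v`. -/
def Adj (G : SSG B) (u v : G.V) : Prop := ∃ b, (u, b, v) ∈ G.E

/-- Series-parallel graphs (SP graphs): built from single edges by sequential and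
parallel composition; as SP graphs are considered up to isomorphism, the collection
is closed under isomorphism. -/
inductive IsSP : SSG B → Prop
  | single (b : B) : IsSP (single b)
  | seq {G G' : SSG B} : IsSP G → IsSP G' → IsSP (G.seq G')
  | par {G G' : SSG B} : IsSP G → IsSP G' → IsSP (G.par G')
  | iso {G G' : SSG B} : IsSP G → G.Iso G' → IsSP G'

/-- A graph is connected if any two vertices are joined by a path in the
underlying undirected graph. -/
def Connected (G : SSG B) : Prop :=
  ∀ u v : G.V, Relation.ReflTransGen (fun a b => G.Adj a b ∨ G.Adj b a) u v

/-- A directed graph is acyclic if it has no (nonempty) directed cycle. -/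
def Acyclic (G : SSG B) : Prop := ∀ v : G.V, ¬ Relation.TransGen G.Adj v v

end SSG
/-!
SAND attack trees: closed terms over `B ∪ {OR, AND, SAND}`, where the unranked
operators take `k ≥ 1` arguments (represented by nonempty lists `SandTreeList`).
-/

mutual
inductive SandTree (B : Type) : Type
  | atom : B → SandTree B
  | or : SandTreeList B → SandTree B
  | and : SandTreeList B → SandTree B
  | sand : SandTreeList B → SandTree B
inductive SandTreeList (B : Type) : Type
  | single : SandTree B → SandTreeList B
  | cons : SandTree B → SandTreeList B → SandTreeList B
end

namespace SandTreeList

variable {B : Type}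

def toList : SandTreeList B → List (SandTree B)
  | .single t => [t]
  | .cons t ts => t :: ts.toList

/-- Prepend a (possibly empty) list of trees to a nonempty argument list. -/
def glue : List (SandTree B) → SandTreeList B → SandTreeList B
  | [], ys => ys
  | x :: xs, ys => .cons x (glue xs ys)

/-- The nonempty argument list `t :: l`. -/
def ofList : SandTree B → List (SandTree B) → SandTreeList B
  | t, [] => .single t
  | t, u :: us => .cons t (ofList u us)

/-- Append a (possibly empty) list of trees to a nonempty argument list. -/
def snoc : SandTreeList B → List (SandTree B) → SandTreeList B
  | .single t, zs => ofList t zs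
  | .cons t ts, zs => .cons t (snoc ts zs)

def map (f : SandTree B → SandTree B) : SandTreeList B → SandTreeList B
  | .single t => .single (f t)
  | .cons t ts => .cons (f t) (map f ts)

end SandTreeList

/-!
The SP semantics `sem` interprets a SAND attack tree as a set of SP graphs
(sets of source-sink graphs closed under isomorphism, since SP graphs are
considered up to isomorphism):
`⟦b⟧ = {→b}`, `⟦OR(t₁,…,t_k)⟧ = ⋃ᵢ ⟦tᵢ⟧`,
`⟦AND(t₁,…,t_k)⟧ = {G₁ ∥ … ∥ G_k | Gᵢ ∈ ⟦tᵢ⟧}`,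
`⟦SAND(t₁,…,t_k)⟧ = {G₁ ⋅ … ⋅ G_k | Gᵢ ∈ ⟦tᵢ⟧}`.
-/

mutual
def sem {B : Type} : SandTree B → Set (SSG B)
  | .atom b => {G | (SSG.single b).Iso G}
  | .or ts => semOr ts
  | .and ts => semAnd ts
  | .sand ts => semSand ts
def semOr {B : Type} : SandTreeList B → Set (SSG B)
  | .single t => sem t
  | .cons t ts => sem t ∪ semOr ts
def semAnd {B : Type} : SandTreeList B → Set (SSG B)
  | .single t => sem t
  | .cons t ts => {G | ∃ G1 ∈ sem t, ∃ G2 ∈ semAnd ts, (G1.par G2).Iso G}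
def semSand {B : Type} : SandTreeList B → Set (SSG B)
  | .single t => sem t
  | .cons t ts => {G | ∃ G1 ∈ sem t, ∃ G2 ∈ semSand ts, (G1.seq G2).Iso G}
end
/-!
Equality of terms modulo commutativity of the unranked operators `OR` and `AND`
(the congruence generated by permuting the arguments of `OR` and `AND` nodes).
-/

mutual
inductive PEq {B : Type} : SandTree B → SandTree B → Prop
  | refl (t : SandTree B) : PEq t t
  | symm {t u : SandTree B} : PEq t u → PEq u t
  | trans {t u v : SandTree B} : PEq t u → PEq u v → PEq t v
  | orPerm {ts ts' : SandTreeList B} : ts.toList.Perm ts'.toList → PEq (.or ts) (.or ts')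
  | andPerm {ts ts' : SandTreeList B} : ts.toList.Perm ts'.toList → PEq (.and ts) (.and ts')
  | orCongr {ts ts' : SandTreeList B} : PEqL ts ts' → PEq (.or ts) (.or ts')
  | andCongr {ts ts' : SandTreeList B} : PEqL ts ts' → PEq (.and ts) (.and ts')
  | sandCongr {ts ts' : SandTreeList B} : PEqL ts ts' → PEq (.sand ts) (.sand ts')
inductive PEqL {B : Type} : SandTreeList B → SandTreeList B → Prop
  | single {t t' : SandTree B} : PEq t t' → PEqL (.single t) (.single t')
  | cons {t t' : SandTree B} {ts ts' : SandTreeList B} :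
      PEq t t' → PEqL ts ts' → PEqL (.cons t ts) (.cons t' ts')
end
/-!
Syntactic consequence from the axiom system `E_SP`.

The axiom schemes are represented by all of their instances (arbitrary argument
terms in place of the variable vectors `X⃗`, `Y⃗`, `Z⃗`); on closed terms this
generates exactly the same derivability relation as variables plus the
substitution rule.  Closure under "replacement in contexts" is represented by
the congruence rules for the three operators.
-/

section
open SandTreeList
mutual
inductive DerivSP {B : Type} : SandTree B → SandTree B → Prop
  /- closure rules -/
  | refl (t : SandTree B) : DerivSP t t
  | symm {t u : SandTree B} : DerivSP t u → DerivSP u t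
  | trans {t u v : SandTree B} : DerivSP t u → DerivSP u v → DerivSP t v
  | congrOr {ts ts' : SandTreeList B} : DerivSPL ts ts' → DerivSP (.or ts) (.or ts')
  | congrAnd {ts ts' : SandTreeList B} : DerivSPL ts ts' → DerivSP (.and ts) (.and ts')
  | congrSand {ts ts' : SandTreeList B} : DerivSPL ts ts' → DerivSP (.sand ts) (.sand ts')
  /- (E1) commutativity of OR -/
  | ax1 {ts ts' : SandTreeList B} : ts.toList.Perm ts'.toList → DerivSP (.or ts) (.or ts')
  /- (E2) commutativity of AND -/
  | ax2 {ts ts' : SandTreeList B} : ts.toList.Perm ts'.toList → DerivSP (.and ts) (.and ts')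
  /- (E3) OR(X⃗, OR(Y⃗)) = OR(X⃗, Y⃗) -/
  | ax3 (xs : List (SandTree B)) (ys : SandTreeList B) :
      DerivSP (.or (glue xs (.single (.or ys)))) (.or (glue xs ys))
  /- (E4) AND(X⃗, AND(Y⃗)) = AND(X⃗, Y⃗) -/
  | ax4 (xs : List (SandTree B)) (ys : SandTreeList B) :
      DerivSP (.and (glue xs (.single (.and ys)))) (.and (glue xs ys))
  /- (E4') SAND(X⃗, SAND(Y⃗), Z⃗) = SAND(X⃗, Y⃗, Z⃗) -/
  | ax4' (xs : List (SandTree B)) (ys : SandTreeList B) (zs : List (SandTree B)) :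
      DerivSP (.sand (glue xs (snoc (.single (.sand ys)) zs))) (.sand (glue xs (snoc ys zs)))
  /- (E5) OR(A) = A -/
  | ax5 (t : SandTree B) : DerivSP (.or (.single t)) t
  /- (E6) AND(A) = A -/
  | ax6 (t : SandTree B) : DerivSP (.and (.single t)) t
  /- (E6') SAND(A) = A -/
  | ax6' (t : SandTree B) : DerivSP (.sand (.single t)) t
  /- (E10) AND(X⃗, OR(Y⃗)) = OR(AND(X⃗,Y₁),…,AND(X⃗,Yₗ)) -/
  | ax10 (xs : List (SandTree B)) (ys : SandTreeList B) :
      DerivSP (.and (glue xs (.single (.or ys))))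
        (.or (SandTreeList.map (fun y => .and (glue xs (.single y))) ys))
  /- (E10') SAND(X⃗, OR(Y⃗), Z⃗) = OR(SAND(X⃗,Y₁,Z⃗),…,SAND(X⃗,Yₗ,Z⃗)) -/
  | ax10' (xs : List (SandTree B)) (ys : SandTreeList B) (zs : List (SandTree B)) :
      DerivSP (.sand (glue xs (snoc (.single (.or ys)) zs)))
        (.or (SandTreeList.map (fun y => .sand (glue xs (snoc (.single y) zs))) ys))
  /- (E11) OR(A, A, X⃗) = OR(A, X⃗) -/
  | ax11 (a : SandTree B) (xs : List (SandTree B)) :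
      DerivSP (.or (.cons a (ofList a xs))) (.or (ofList a xs))
inductive DerivSPL {B : Type} : SandTreeList B → SandTreeList B → Prop
  | single {t t' : SandTree B} : DerivSP t t' → DerivSPL (.single t) (.single t')
  | cons {t t' : SandTree B} {ts ts' : SandTreeList B} :
      DerivSP t t' → DerivSPL ts ts' → DerivSPL (.cons t ts) (.cons t' ts')
end
end

/-! Syntactic consequence from the SAND-free fragment
`E_SM = {E1, E2, E3, E4, E5, E6, E10, E11}` of `E_SP` (formulated over the full
signature of SAND attack trees). -/
section
open SandTreeList
mutual
inductive DerivSM {B : Type} : SandTree B → SandTree B → Prop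
  | refl (t : SandTree B) : DerivSM t t
  | symm {t u : SandTree B} : DerivSM t u → DerivSM u t
  | trans {t u v : SandTree B} : DerivSM t u → DerivSM u v → DerivSM t v
  | congrOr {ts ts' : SandTreeList B} : DerivSML ts ts' → DerivSM (.or ts) (.or ts')
  | congrAnd {ts ts' : SandTreeList B} : DerivSML ts ts' → DerivSM (.and ts) (.and ts')
  | congrSand {ts ts' : SandTreeList B} : DerivSML ts ts' → DerivSM (.sand ts) (.sand ts')
  | ax1 {ts ts' : SandTreeList B} : ts.toList.Perm ts'.toList → DerivSM (.or ts) (.or ts')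
  | ax2 {ts ts' : SandTreeList B} : ts.toList.Perm ts'.toList → DerivSM (.and ts) (.and ts')
  | ax3 (xs : List (SandTree B)) (ys : SandTreeList B) :
      DerivSM (.or (glue xs (.single (.or ys)))) (.or (glue xs ys))
  | ax4 (xs : List (SandTree B)) (ys : SandTreeList B) :
      DerivSM (.and (glue xs (.single (.and ys)))) (.and (glue xs ys))
  | ax5 (t : SandTree B) : DerivSM (.or (.single t)) t
  | ax6 (t : SandTree B) : DerivSM (.and (.single t)) t
  | ax10 (xs : List (SandTree B)) (ys : SandTreeList B) :
      DerivSM (.and (glue xs (.single (.or ys))))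
        (.or (SandTreeList.map (fun y => .and (glue xs (.single y))) ys))
  | ax11 (a : SandTree B) (xs : List (SandTree B)) :
      DerivSM (.or (.cons a (ofList a xs))) (.or (ofList a xs))
inductive DerivSML {B : Type} : SandTreeList B → SandTreeList B → Prop
  | single {t t' : SandTree B} : DerivSM t t' → DerivSML (.single t) (.single t')
  | cons {t t' : SandTree B} {ts ts' : SandTreeList B} :
      DerivSM t t' → DerivSML ts ts' → DerivSML (.cons t ts) (.cons t' ts')
end
end
/-!
The normal-form grammar (for `k ≥ 2`, `b ∈ B`):
`N ::= A | OR(A₁,…,A_k)` (with pairwise distinct `Aᵢ`),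
`A ::= C | S`, `C ::= b | AND(S₁,…,S_k)`, `S ::= b | SAND(C₁,…,C_k)`.
-/

mutual
inductive IsC {B : Type} : SandTree B → Prop
  | atom (b : B) : IsC (.atom b)
  | and {ts : SandTreeList B} : 2 ≤ ts.toList.length → IsSL ts → IsC (.and ts)
inductive IsS {B : Type} : SandTree B → Prop
  | atom (b : B) : IsS (.atom b)
  | sand {ts : SandTreeList B} : 2 ≤ ts.toList.length → IsCL ts → IsS (.sand ts)
inductive IsSL {B : Type} : SandTreeList B → Prop
  | single {t : SandTree B} : IsS t → IsSL (.single t)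
  | cons {t : SandTree B} {ts : SandTreeList B} : IsS t → IsSL ts → IsSL (.cons t ts)
inductive IsCL {B : Type} : SandTreeList B → Prop
  | single {t : SandTree B} : IsC t → IsCL (.single t)
  | cons {t : SandTree B} {ts : SandTreeList B} : IsC t → IsCL ts → IsCL (.cons t ts)
end

/-- Terms generated by the non-terminal `A` of the normal-form grammar. -/
def IsA {B : Type} (t : SandTree B) : Prop := IsC t ∨ IsS t

/-- Terms generated by the non-terminal `N` of the normal-form grammar; as terms
are considered modulo commutativity of `OR` and `AND`, the arguments of the `OR`
are required to be pairwise distinct modulo commutativity. -/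
def IsN {B : Type} (t : SandTree B) : Prop :=
  IsA t ∨ ∃ ts : SandTreeList B, t = .or ts ∧ 2 ≤ ts.toList.length ∧
    (∀ u ∈ ts.toList, IsA u) ∧ ts.toList.Pairwise (fun a b => ¬ PEq a b)

/-!
The term rewriting system obtained by orienting the axioms
(E3), (E4), (E4'), (E5), (E6), (E6'), (E10), (E10'), (E11) from left to right,
applied in any context, modulo commutativity of `OR` and `AND`.
-/

section
open SandTreeList

/-- Rule application at the root. -/
inductive RStep {B : Type} : SandTree B → SandTree B → Prop
  | r3 (xs : List (SandTree B)) (ys : SandTreeList B) :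
      RStep (.or (glue xs (.single (.or ys)))) (.or (glue xs ys))
  | r4 (xs : List (SandTree B)) (ys : SandTreeList B) :
      RStep (.and (glue xs (.single (.and ys)))) (.and (glue xs ys))
  | r4' (xs : List (SandTree B)) (ys : SandTreeList B) (zs : List (SandTree B)) :
      RStep (.sand (glue xs (snoc (.single (.sand ys)) zs))) (.sand (glue xs (snoc ys zs)))
  | r5 (t : SandTree B) : RStep (.or (.single t)) t
  | r6 (t : SandTree B) : RStep (.and (.single t)) t
  | r6' (t : SandTree B) : RStep (.sand (.single t)) t
  | r10 (xs : List (SandTree B)) (ys : SandTreeList B) :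
      RStep (.and (glue xs (.single (.or ys))))
        (.or (SandTreeList.map (fun y => .and (glue xs (.single y))) ys))
  | r10' (xs : List (SandTree B)) (ys : SandTreeList B) (zs : List (SandTree B)) :
      RStep (.sand (glue xs (snoc (.single (.or ys)) zs)))
        (.or (SandTreeList.map (fun y => .sand (glue xs (snoc (.single y) zs))) ys))
  | r11 (a : SandTree B) (xs : List (SandTree B)) :
      RStep (.or (.cons a (ofList a xs))) (.or (ofList a xs))

end

/-! Rule application in an arbitrary context. -/
mutual
inductive Rw {B : Type} : SandTree B → SandTree B → Prop
  | root {t t' : SandTree B} : RStep t t' → Rw t t'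
  | or {ts ts' : SandTreeList B} : RwL ts ts' → Rw (.or ts) (.or ts')
  | and {ts ts' : SandTreeList B} : RwL ts ts' → Rw (.and ts) (.and ts')
  | sand {ts ts' : SandTreeList B} : RwL ts ts' → Rw (.sand ts) (.sand ts')
inductive RwL {B : Type} : SandTreeList B → SandTreeList B → Prop
  | single {t t' : SandTree B} : Rw t t' → RwL (.single t) (.single t')
  | head {t t' : SandTree B} {ts : SandTreeList B} : Rw t t' → RwL (.cons t ts) (.cons t' ts)
  | tail {t : SandTree B} {ts ts' : SandTreeList B} : RwL ts ts' → RwL (.cons t ts) (.cons t ts')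
end

/-- One rewrite step of the TRS `⇒`, working modulo commutativity of `OR` and `AND`. -/
def RwMod {B : Type} (t t' : SandTree B) : Prop :=
  ∃ u u' : SandTree B, PEq t u ∧ Rw u u' ∧ PEq u' t'

/-- Zero or more rewrite steps (modulo commutativity of `OR` and `AND`). -/
def RwStar {B : Type} : SandTree B → SandTree B → Prop :=
  Relation.ReflTransGen (fun a b => PEq a b ∨ Rw a b)

/-- A normal form: no rewrite rule is applicable, modulo commutativity of `OR` and `AND`. -/
def NormalForm {B : Type} (t : SandTree B) : Prop :=
  ∀ u t' : SandTree B, PEq t u → ¬ Rw u t'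

/-! The norm `‖·‖`: `‖b‖ = 1`, `‖OR(t₁,…,t_k)‖ = ‖t₁‖+…+‖t_k‖+2`,
`‖AND(t₁,…,t_k)‖ = ‖SAND(t₁,…,t_k)‖ = 2·‖t₁‖·…·‖t_k‖`. -/
mutual
def weight {B : Type} : SandTree B → ℕ
  | .atom _ => 1
  | .or ts => weightSum ts + 2
  | .and ts => 2 * weightProd ts
  | .sand ts => 2 * weightProd ts
def weightSum {B : Type} : SandTreeList B → ℕ
  | .single t => weight t
  | .cons t ts => weight t + weightSum ts
def weightProd {B : Type} : SandTreeList B → ℕ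
  | .single t => weight t
  | .cons t ts => weight t * weightProd ts
end
/-!
Standard attack trees are SAND attack trees containing no `SAND` operator.
The multiset semantics maps a standard attack tree to a set of finite multisets
over `B`: `⟦b⟧_M = {⟨b⟩}`, `⟦OR⟧_M = ⋃ᵢ ⟦tᵢ⟧_M`,
`⟦AND⟧_M = {M₁ ⊎ … ⊎ M_k | Mᵢ ∈ ⟦tᵢ⟧_M}`.
(Its value on trees containing `SAND` is irrelevant and set to `∅`.)
-/

mutual
inductive NoSand {B : Type} : SandTree B → Prop
  | atom (b : B) : NoSand (.atom b)
  | or {ts : SandTreeList B} : NoSandL ts → NoSand (.or ts)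
  | and {ts : SandTreeList B} : NoSandL ts → NoSand (.and ts)
inductive NoSandL {B : Type} : SandTreeList B → Prop
  | single {t : SandTree B} : NoSand t → NoSandL (.single t)
  | cons {t : SandTree B} {ts : SandTreeList B} : NoSand t → NoSandL ts → NoSandL (.cons t ts)
end

mutual
def msem {B : Type} : SandTree B → Set (Multiset B)
  | .atom b => {({b} : Multiset B)}
  | .or ts => msemOr ts
  | .and ts => msemAnd ts
  | .sand _ => ∅
def msemOr {B : Type} : SandTreeList B → Set (Multiset B)
  | .single t => msem t
  | .cons t ts => msem t ∪ msemOr ts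
def msemAnd {B : Type} : SandTreeList B → Set (Multiset B)
  | .single t => msem t
  | .cons t ts => {M | ∃ M1 ∈ msem t, ∃ M2 ∈ msemAnd ts, M = M1 + M2}
end

/-- Parallel composition of a nonempty list of graphs `G ∥ H₁ ∥ … ∥ H_k`. -/
def parAll {B : Type} : SSG B → List (SSG B) → SSG B
  | G, [] => G
  | G, H :: Hs => parAll (G.par H) Hs

/-- SAND attack trees modulo equivalence with respect to the SP semantics
(`t ~ t'` iff `⟦t⟧ = ⟦t'⟧`). -/
def semSetoid (B : Type) : Setoid (SandTree B) :=
  ⟨fun t t' => sem t = sem t', fun _ => rfl, Eq.symm, Eq.trans⟩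

/-- The map induced by the SP semantics on equivalence classes of SAND attack trees. -/
def semClass {B : Type} : Quotient (semSetoid B) → Set (SSG B) :=
  Quotient.lift sem (fun _ _ h => h)

/-!
Bottom-up evaluation of the minimal attack time attribute on SAND attack trees:
`α(b) = β(b)`, `α(OR) = min`, `α(AND) = max`, `α(SAND) = Σ`.
-/

mutual
def attr {B : Type} (β : B → NNReal) : SandTree B → NNReal
  | .atom b => β b
  | .or ts => attrOr β ts
  | .and ts => attrAnd β ts
  | .sand ts => attrSand β ts
def attrOr {B : Type} (β : B → NNReal) : SandTreeList B → NNReal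
  | .single t => attr β t
  | .cons t ts => min (attr β t) (attrOr β ts)
def attrAnd {B : Type} (β : B → NNReal) : SandTreeList B → NNReal
  | .single t => attr β t
  | .cons t ts => max (attr β t) (attrAnd β ts)
def attrSand {B : Type} (β : B → NNReal) : SandTreeList B → NNReal
  | .single t => attr β t
  | .cons t ts => attr β t + attrSand β ts
end
/-!
Standard attack trees as a standalone signature (`B ∪ {OR, AND}`, unranked
operators with `k ≥ 1` arguments), their multiset semantics, and syntactic
consequence from the axiom system `E_SM`.
-/

mutual
inductive ATree (B : Type) : Type
  | atom : B → ATree B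
  | or : ATreeList B → ATree B
  | and : ATreeList B → ATree B
inductive ATreeList (B : Type) : Type
  | single : ATree B → ATreeList B
  | cons : ATree B → ATreeList B → ATreeList B
end

namespace ATreeList

variable {B : Type}

def toList : ATreeList B → List (ATree B)
  | .single t => [t]
  | .cons t ts => t :: ts.toList

def glue : List (ATree B) → ATreeList B → ATreeList B
  | [], ys => ys
  | x :: xs, ys => .cons x (glue xs ys)

def ofList : ATree B → List (ATree B) → ATreeList B
  | t, [] => .single t
  | t, u :: us => .cons t (ofList u us)

def map (f : ATree B → ATree B) : ATreeList B → ATreeList B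
  | .single t => .single (f t)
  | .cons t ts => .cons (f t) (map f ts)

end ATreeList

/-! The multiset semantics of standard attack trees. -/

mutual
def amsem {B : Type} : ATree B → Set (Multiset B)
  | .atom b => {({b} : Multiset B)}
  | .or ts => amsemOr ts
  | .and ts => amsemAnd ts
def amsemOr {B : Type} : ATreeList B → Set (Multiset B)
  | .single t => amsem t
  | .cons t ts => amsem t ∪ amsemOr ts
def amsemAnd {B : Type} : ATreeList B → Set (Multiset B)
  | .single t => amsem t
  | .cons t ts => {M | ∃ M1 ∈ amsem t, ∃ M2 ∈ amsemAnd ts, M = M1 + M2}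
end

/-!
Syntactic consequence from `E_SM = {E1, E2, E3, E4, E5, E6, E10, E11}`.
Axiom schemes are represented by all of their instances (closure under
substitution is then automatic), and closure under replacement in contexts is
represented by the congruence rules.
-/

section
open ATreeList
mutual
inductive DerivASM {B : Type} : ATree B → ATree B → Prop
  | refl (t : ATree B) : DerivASM t t
  | symm {t u : ATree B} : DerivASM t u → DerivASM u t
  | trans {t u v : ATree B} : DerivASM t u → DerivASM u v → DerivASM t v
  | congrOr {ts ts' : ATreeList B} : DerivASML ts ts' → DerivASM (.or ts) (.or ts')
  | congrAnd {ts ts' : ATreeList B} : DerivASML ts ts' → DerivASM (.and ts) (.and ts')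
  /- (E1) -/
  | ax1 {ts ts' : ATreeList B} : ts.toList.Perm ts'.toList → DerivASM (.or ts) (.or ts')
  /- (E2) -/
  | ax2 {ts ts' : ATreeList B} : ts.toList.Perm ts'.toList → DerivASM (.and ts) (.and ts')
  /- (E3) -/
  | ax3 (xs : List (ATree B)) (ys : ATreeList B) :
      DerivASM (.or (glue xs (.single (.or ys)))) (.or (glue xs ys))
  /- (E4) -/
  | ax4 (xs : List (ATree B)) (ys : ATreeList B) :
      DerivASM (.and (glue xs (.single (.and ys)))) (.and (glue xs ys))
  /- (E5) -/
  | ax5 (t : ATree B) : DerivASM (.or (.single t)) t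
  /- (E6) -/
  | ax6 (t : ATree B) : DerivASM (.and (.single t)) t
  /- (E10) -/
  | ax10 (xs : List (ATree B)) (ys : ATreeList B) :
      DerivASM (.and (glue xs (.single (.or ys))))
        (.or (ATreeList.map (fun y => .and (glue xs (.single y))) ys))
  /- (E11) -/
  | ax11 (a : ATree B) (xs : List (ATree B)) :
      DerivASM (.or (.cons a (ofList a xs))) (.or (ofList a xs))
inductive DerivASML {B : Type} : ATreeList B → ATreeList B → Prop
  | single {t t' : ATree B} : DerivASM t t' → DerivASML (.single t) (.single t')
  | cons {t t' : ATree B} {ts ts' : ATreeList B} :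
      DerivASM t t' → DerivASML ts ts' → DerivASML (.cons t ts) (.cons t' ts')
end
end

namespace SandTreeList

variable {B : Type}

theorem toList_injective : Function.Injective (toList : SandTreeList B → List (SandTree B)) := by
  intro ts us h
  have hne (vs : SandTreeList B) : vs.toList ≠ [] := by cases vs <;> simp [toList]
  induction ts using SandTreeList.rec (motive_1 := fun _ => True) generalizing us with
  | single t _ =>
    cases us with
    | single u => simpa [toList] using h
    | cons u us => exact absurd (List.cons.inj h).2.symm (hne us)
  | cons t ts _ ih =>
    cases us with
    | single u => exact absurd (List.cons.inj h).2 (hne ts)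
    | cons u us =>
      obtain ⟨rfl, h'⟩ := List.cons.inj h
      rw [ih h']
  | _ => trivial

@[simp] theorem toList_single (t : SandTree B) : (single t).toList = [t] := rfl

@[simp] theorem toList_cons (t : SandTree B) (ts : SandTreeList B) :
    (cons t ts).toList = t :: ts.toList := rfl

@[simp] theorem toList_glue (xs : List (SandTree B)) (ys : SandTreeList B) :
    (glue xs ys).toList = xs ++ ys.toList := by
  induction xs with
  | nil => rfl
  | cons x xs ih => simp [glue, ih]

@[simp] theorem toList_ofList (t : SandTree B) (l : List (SandTree B)) :
    (ofList t l).toList = t :: l := by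
  induction l generalizing t with
  | nil => rfl
  | cons u us ih => simp [ofList, ih]

@[simp] theorem toList_snoc : ∀ (ts : SandTreeList B) (zs : List (SandTree B)),
    (snoc ts zs).toList = ts.toList ++ zs
  | .single _, _ => by simp [snoc]
  | .cons _ ts, zs => by simp [snoc, toList_snoc ts zs]

@[simp] theorem toList_map (f : SandTree B → SandTree B) :
    ∀ ts : SandTreeList B, (map f ts).toList = ts.toList.map f
  | .single _ => rfl
  | .cons _ ts => by simp [map, toList_map f ts]

theorem snoc_nil (ts : SandTreeList B) : snoc ts [] = ts := toList_injective (by simp)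

/-- Substitute a nonempty argument list for every argument. -/
def bind (f : SandTree B → SandTreeList B) : SandTreeList B → SandTreeList B
  | .single t => f t
  | .cons t ts => glue (f t).toList (bind f ts)

@[simp] theorem toList_bind (f : SandTree B → SandTreeList B) :
    ∀ ts : SandTreeList B, (bind f ts).toList = ts.toList.flatMap fun t => (f t).toList
  | .single _ => by simp [bind]
  | .cons _ ts => by simp [bind, toList_bind f ts]

theorem map_map (f g : SandTree B → SandTree B) (ts : SandTreeList B) :
    map f (map g ts) = map (fun t => f (g t)) ts :=
  toList_injective (by simp)

theorem map_bind (f : SandTree B → SandTree B) (g : SandTree B → SandTreeList B)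
    (ts : SandTreeList B) : map f (bind g ts) = bind (fun t => map f (g t)) ts :=
  toList_injective (by simp [List.map_flatMap])

/-- A product over a nonempty argument list in a commutative semigroup is invariant under
permuting the arguments. -/
theorem prod_eq_of_perm {M : Type*} [CommSemigroup M] {f : SandTree B → M}
    {F : SandTreeList B → M} (single : ∀ t, F (.single t) = f t)
    (cons : ∀ t ts, F (.cons t ts) = f t * F ts) {ts ts' : SandTreeList B}
    (h : ts.toList.Perm ts'.toList) : F ts = F ts' := by
  have key : ∀ ts : SandTreeList B,
      (F ts : WithOne M) = (ts.toList.map fun t => (f t : WithOne M)).prod := by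
    intro ts
    induction ts using SandTreeList.rec (motive_1 := fun _ => True) with
    | single t _ => simp [single]
    | cons t ts _ ih => simp [cons, ih]
    | _ => trivial
  exact WithOne.coe_injective (by rw [key, key, (h.map _).prod_eq])

end SandTreeList

section Termination

variable {B : Type}

open SandTreeList

theorem weightSum_eq : ∀ ts : SandTreeList B, weightSum ts = (ts.toList.map weight).sum
  | .single _ => by simp [weightSum]
  | .cons _ ts => by simp [weightSum, weightSum_eq ts]

theorem weightProd_eq : ∀ ts : SandTreeList B, weightProd ts = (ts.toList.map weight).prod
  | .single _ => by simp [weightProd]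
  | .cons _ ts => by simp [weightProd, weightProd_eq ts]

mutual
theorem weight_pos : ∀ t : SandTree B, 0 < weight t
  | .atom _ => by simp [weight]
  | .or _ => by simp [weight]
  | .and ts => by simpa [weight] using weightProd_pos ts
  | .sand ts => by simpa [weight] using weightProd_pos ts
theorem weightProd_pos : ∀ ts : SandTreeList B, 0 < weightProd ts
  | .single t => by simpa [weightProd] using weight_pos t
  | .cons t ts => by simpa [weightProd] using ⟨weight_pos t, weightProd_pos ts⟩
end

theorem prod_map_weight_pos (l : List (SandTree B)) : 0 < (l.map weight).prod :=
  List.prod_pos (by simpa using fun t _ => weight_pos t)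

mutual
theorem PEq.weight_eq {t u : SandTree B} : PEq t u → weight t = weight u
  | .refl _ => rfl
  | .symm h => h.weight_eq.symm
  | .trans h h' => h.weight_eq.trans h'.weight_eq
  | .orPerm h => by simp [weight, weightSum_eq, (h.map weight).sum_eq]
  | .andPerm h => by simp [weight, weightProd_eq, (h.map weight).prod_eq]
  | .orCongr h => by simp [weight, h.weight_eq.1]
  | .andCongr h => by simp [weight, h.weight_eq.2]
  | .sandCongr h => by simp [weight, h.weight_eq.2]
theorem PEqL.weight_eq {ts us : SandTreeList B} :
    PEqL ts us → weightSum ts = weightSum us ∧ weightProd ts = weightProd us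
  | .single h => by simp [weightSum, weightProd, h.weight_eq]
  | .cons h h' => by simp [weightSum, weightProd, h.weight_eq, h'.weight_eq]
end

theorem RStep.weight_lt {t u : SandTree B} (h : RStep t u) : weight u < weight t := by
  cases h with
  | r3 xs ys => simp [weight, weightSum_eq]
  | r4 xs ys =>
    have := Nat.mul_pos (prod_map_weight_pos xs) (prod_map_weight_pos ys.toList)
    simp [weight, weightProd_eq]
    linarith
  | r4' xs ys zs =>
    have := Nat.mul_pos (prod_map_weight_pos xs)
      (Nat.mul_pos (prod_map_weight_pos ys.toList) (prod_map_weight_pos zs))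
    simp [weight, weightProd_eq]
    linarith
  | r5 => simp [weight, weightSum]
  | r6 => simp [weight, weightProd, weight_pos]
  | r6' => simp [weight, weightProd, weight_pos]
  | r10 xs ys =>
    have := prod_map_weight_pos xs
    simp [weight, weightProd_eq, weightSum_eq, Function.comp_def, List.sum_map_mul_left]
    linarith
  | r10' xs ys zs =>
    have := Nat.mul_pos (prod_map_weight_pos xs) (prod_map_weight_pos zs)
    simp [weight, weightProd_eq, weightSum_eq, Function.comp_def, List.sum_map_mul_left,
      List.sum_map_mul_right]
    linarith
  | r11 a xs =>
    have := weight_pos a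
    simp [weight, weightSum_eq]
    linarith

mutual
theorem Rw.weight_lt {t u : SandTree B} : Rw t u → weight u < weight t
  | .root h => h.weight_lt
  | .or h => by simpa [weight] using h.weight_lt.1
  | .and h => by simpa [weight] using h.weight_lt.2
  | .sand h => by simpa [weight] using h.weight_lt.2
theorem RwL.weight_lt {ts us : SandTreeList B} :
    RwL ts us → weightSum us < weightSum ts ∧ weightProd us < weightProd ts
  | .single h => by simpa [weightSum, weightProd] using h.weight_lt
  | .head (ts := ts) h => by
      simpa [weightSum, weightProd, weightProd_pos ts] using h.weight_lt
  | .tail (t := t) h => by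
      simpa [weightSum, weightProd, weight_pos t] using h.weight_lt
end

theorem RwMod.weight_lt {t u : SandTree B} : RwMod t u → weight u < weight t := by
  rintro ⟨v, w, hv, h, hw⟩
  rw [hv.weight_eq, ← hw.weight_eq]
  exact h.weight_lt

end Termination

section Denotation

variable {B : Type}

open SandTreeList

theorem PEqL.refl : ∀ ts : SandTreeList B, PEqL ts ts
  | .single t => .single (.refl t)
  | .cons t ts => .cons (.refl t) (PEqL.refl ts)

theorem PEqL.glue (xs : List (SandTree B)) {ts ts' : SandTreeList B} (h : PEqL ts ts') :
    PEqL (glue xs ts) (glue xs ts') := by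
  induction xs with
  | nil => exact h
  | cons x xs ih => exact .cons (.refl x) ih

theorem PEqL.snoc (zs : List (SandTree B)) {ts ts' : SandTreeList B} :
    PEqL ts ts' → PEqL (snoc ts zs) (snoc ts' zs)
  | .single h => by
      cases zs with
      | nil => exact .single h
      | cons z zs => exact .cons h (.refl _)
  | .cons h h' => .cons h (PEqL.snoc zs h')

theorem PEqL.map {f g : SandTree B → SandTree B} (h : ∀ t, PEq (f t) (g t)) :
    ∀ ts : SandTreeList B, PEqL (ts.map f) (ts.map g)
  | .single t => .single (h t)
  | .cons t ts => .cons (h t) (PEqL.map h ts)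

namespace SandTree

/-- The conjuncts of a tree. -/
def andArgs : SandTree B → SandTreeList B
  | .and ts => ts
  | t => .single t

/-- The sequential conjuncts of a tree. -/
def sandArgs : SandTree B → SandTreeList B
  | .sand ts => ts
  | t => .single t

/-- Flattened binary conjunction. -/
def par (t u : SandTree B) : SandTree B := .and (snoc t.andArgs u.andArgs.toList)

/-- Flattened binary sequential conjunction. -/
def ser (t u : SandTree B) : SandTree B := .sand (snoc t.sandArgs u.sandArgs.toList)

theorem par_assoc (t u v : SandTree B) : par (par t u) v = par t (par u v) :=
  congrArg SandTree.and (toList_injective (by simp [par, andArgs]))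

theorem ser_assoc (t u v : SandTree B) : ser (ser t u) v = ser t (ser u v) :=
  congrArg SandTree.sand (toList_injective (by simp [ser, sandArgs]))

theorem par_comm (t u : SandTree B) : PEq (par t u) (par u t) :=
  .andPerm (by simpa using List.perm_append_comm)

end SandTree

open SandTree

theorem PEq.and_andArgs {t t' : SandTree B} (xs zs : List (SandTree B)) : PEq t t' →
    PEq (.and (glue xs (snoc t.andArgs zs))) (.and (glue xs (snoc t'.andArgs zs)))
  | .refl _ => .refl _
  | .symm h => (h.and_andArgs xs zs).symm
  | .trans h h' => (h.and_andArgs xs zs).trans (h'.and_andArgs xs zs)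
  | .orPerm h => .andCongr (((PEqL.single (.orPerm h)).snoc zs).glue xs)
  | .orCongr h => .andCongr (((PEqL.single (.orCongr h)).snoc zs).glue xs)
  | .andPerm h => .andPerm (by simpa [andArgs] using (h.append_right zs).append_left xs)
  | .andCongr h => .andCongr ((h.snoc zs).glue xs)
  | .sandCongr h => .andCongr (((PEqL.single (.sandCongr h)).snoc zs).glue xs)

theorem PEq.sand_sandArgs {t t' : SandTree B} (xs zs : List (SandTree B)) : PEq t t' →
    PEq (.sand (glue xs (snoc t.sandArgs zs))) (.sand (glue xs (snoc t'.sandArgs zs)))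
  | .refl _ => .refl _
  | .symm h => (h.sand_sandArgs xs zs).symm
  | .trans h h' => (h.sand_sandArgs xs zs).trans (h'.sand_sandArgs xs zs)
  | .orPerm h => .sandCongr (((PEqL.single (.orPerm h)).snoc zs).glue xs)
  | .orCongr h => .sandCongr (((PEqL.single (.orCongr h)).snoc zs).glue xs)
  | .andPerm h => .sandCongr (((PEqL.single (.andPerm h)).snoc zs).glue xs)
  | .andCongr h => .sandCongr (((PEqL.single (.andCongr h)).snoc zs).glue xs)
  | .sandCongr h => .sandCongr ((h.snoc zs).glue xs)

theorem glue_toList_snoc_nil (ts us : SandTreeList B) :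
    glue ts.toList (snoc us []) = snoc ts us.toList :=
  toList_injective (by simp)

theorem PEq.par {t t' u u' : SandTree B} (h : PEq t t') (h' : PEq u u') :
    PEq (par t u) (par t' u') := by
  refine (h.and_andArgs [] u.andArgs.toList).trans ?_
  simpa only [glue, glue_toList_snoc_nil, SandTree.par] using
    h'.and_andArgs t'.andArgs.toList []

theorem PEq.ser {t t' u u' : SandTree B} (h : PEq t t') (h' : PEq u u') :
    PEq (ser t u) (ser t' u') := by
  refine (h.sand_sandArgs [] u.sandArgs.toList).trans ?_
  simpa only [glue, glue_toList_snoc_nil, SandTree.ser] using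
    h'.sand_sandArgs t'.sandArgs.toList []

/-- Equality of trees modulo commutativity, as a setoid. -/
def PEq.setoid (B : Type) : Setoid (SandTree B) := ⟨PEq, .refl, .symm, .trans⟩

/-- Trees modulo commutativity of `OR` and `AND`. -/
abbrev TreeClass (B : Type) : Type := Quotient (PEq.setoid B)

namespace TreeClass

/-- The class of a tree. -/
def mk (t : SandTree B) : TreeClass B := Quotient.mk _ t

theorem mk_eq_mk {t u : SandTree B} : mk t = mk u ↔ PEq t u := Quotient.eq (r := PEq.setoid B)

def par : TreeClass B → TreeClass B → TreeClass B :=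
  Quotient.map₂ SandTree.par fun _ _ h _ _ h' => PEq.par h h'

def ser : TreeClass B → TreeClass B → TreeClass B :=
  Quotient.map₂ SandTree.ser fun _ _ h _ _ h' => PEq.ser h h'

theorem par_assoc (p q r : TreeClass B) : par (par p q) r = par p (par q r) :=
  Quotient.inductionOn₃ p q r fun t u v => congrArg mk (SandTree.par_assoc t u v)

theorem ser_assoc (p q r : TreeClass B) : ser (ser p q) r = ser p (ser q r) :=
  Quotient.inductionOn₃ p q r fun t u v => congrArg mk (SandTree.ser_assoc t u v)

theorem par_comm (p q : TreeClass B) : par p q = par q p :=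
  Quotient.inductionOn₂ p q fun t u => mk_eq_mk.2 (SandTree.par_comm t u)

end TreeClass

mutual
/-- The flattened disjuncts of a tree, modulo commutativity. -/
def den : SandTree B → Set (TreeClass B)
  | .atom b => {TreeClass.mk (.atom b)}
  | .or ts => denOr ts
  | .and ts => denAnd ts
  | .sand ts => denSand ts
def denOr : SandTreeList B → Set (TreeClass B)
  | .single t => den t
  | .cons t ts => den t ∪ denOr ts
def denAnd : SandTreeList B → Set (TreeClass B)
  | .single t => den t
  | .cons t ts => Set.image2 TreeClass.par (den t) (denAnd ts)
def denSand : SandTreeList B → Set (TreeClass B)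
  | .single t => den t
  | .cons t ts => Set.image2 TreeClass.ser (den t) (denSand ts)
end

theorem mem_denOr {q : TreeClass B} :
    ∀ {ts : SandTreeList B}, q ∈ denOr ts ↔ ∃ t ∈ ts.toList, q ∈ den t
  | .single _ => by simp [denOr]
  | .cons _ ts => by simp [denOr, mem_denOr (ts := ts)]

theorem denAnd_eq_of_perm {ts ts' : SandTreeList B} (h : ts.toList.Perm ts'.toList) :
    denAnd ts = denAnd ts' := by
  let _ : CommSemigroup (Set (TreeClass B)) :=
    { mul := Set.image2 TreeClass.par
      mul_assoc := fun _ _ _ => Set.image2_assoc TreeClass.par_assoc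
      mul_comm := fun _ _ => Set.image2_comm TreeClass.par_comm }
  exact prod_eq_of_perm (f := den) (fun _ => by rw [denAnd]) (fun _ _ => by rw [denAnd]; rfl) h

mutual
theorem PEq.den_eq {t u : SandTree B} : PEq t u → den t = den u
  | .refl _ => rfl
  | .symm h => h.den_eq.symm
  | .trans h h' => h.den_eq.trans h'.den_eq
  | .orPerm h => by ext q; simp only [den, mem_denOr, h.mem_iff]
  | .andPerm h => by simp only [den, denAnd_eq_of_perm h]
  | .orCongr h => by simp only [den, h.den_eq]
  | .andCongr h => by simp only [den, h.den_eq]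
  | .sandCongr h => by simp only [den, h.den_eq]
theorem PEqL.den_eq {ts us : SandTreeList B} :
    PEqL ts us → denOr ts = denOr us ∧ denAnd ts = denAnd us ∧ denSand ts = denSand us
  | .single h => by simp only [denOr, denAnd, denSand, h.den_eq, and_self]
  | .cons h h' => by simp only [denOr, denAnd, denSand, h.den_eq, h'.den_eq, and_self]
end

theorem image2_denOr_map (m : TreeClass B → TreeClass B → TreeClass B) (s : Set (TreeClass B))
    (f g : SandTree B → SandTree B) (h : ∀ t, den (g t) = Set.image2 m s (den (f t))) :
    ∀ ts : SandTreeList B, Set.image2 m s (denOr (ts.map f)) = denOr (ts.map g)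
  | .single t => by simp [SandTreeList.map, denOr, h]
  | .cons t ts => by
      simp [SandTreeList.map, denOr, h, Set.image2_union_right, image2_denOr_map m s f g h ts]

theorem denSand_snoc_ofList (z : SandTree B) (zs : List (SandTree B)) :
    ∀ ys : SandTreeList B, denSand (snoc ys (z :: zs)) =
      Set.image2 TreeClass.ser (denSand ys) (denSand (ofList z zs))
  | .single t => by simp [snoc, ofList, denSand]
  | .cons t ts => by
      simp [snoc, denSand, denSand_snoc_ofList z zs ts, Set.image2_assoc TreeClass.ser_assoc]

theorem denSand_snoc_single_sand (ys : SandTreeList B) (zs : List (SandTree B)) :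
    denSand (snoc (.single (.sand ys)) zs) = denSand (snoc ys zs) := by
  cases zs with
  | nil =>
    simp [snoc_nil, denSand, den]
  | cons z zs => simp [denSand_snoc_ofList, denSand, den]

theorem denSand_snoc_single_or (ys : SandTreeList B) (zs : List (SandTree B)) :
    denSand (snoc (.single (.or ys)) zs) =
      denOr (ys.map fun y => .sand (snoc (.single y) zs)) := by
  ext q
  cases zs with
  | nil => simp [snoc, ofList, denSand, den, mem_denOr]
  | cons z zs =>
    simp only [denSand_snoc_ofList, denSand, den, mem_denOr, toList_map, List.mem_map,
      Set.mem_image2, exists_exists_and_eq_and]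
    grind

theorem RStep.den_eq {t u : SandTree B} (h : RStep t u) : den t = den u := by
  cases h with
  | r3 xs ys =>
    ext q
    simp [den, mem_denOr, or_and_right, exists_or]
  | r4 xs ys =>
    induction xs with
    | nil => simp [glue, den, denAnd]
    | cons x xs ih => simp_all [glue, den, denAnd]
  | r4' xs ys zs =>
    induction xs with
    | nil => simp [glue, den, denSand_snoc_single_sand]
    | cons x xs ih => simp_all [glue, den, denSand]
  | r5 => simp [den, denOr]
  | r6 => simp [den, denAnd]
  | r6' => simp [den, denSand]
  | r10 xs ys =>
    induction xs with
    | nil =>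
      ext q
      simp [glue, den, denAnd, mem_denOr]
    | cons x xs ih =>
      simp only [glue, den, denAnd] at ih ⊢
      rw [ih]
      exact image2_denOr_map _ _ _ _ (fun _ => by simp only [den, denAnd]) ys
  | r10' xs ys zs =>
    induction xs with
    | nil => simp only [glue, den, denSand_snoc_single_or]
    | cons x xs ih =>
      simp only [glue, den, denSand] at ih ⊢
      rw [ih]
      exact image2_denOr_map _ _ _ _ (fun _ => by simp only [den, denSand]) ys
  | r11 a xs =>
    ext q
    simp [den, mem_denOr]

mutual
theorem Rw.den_eq {t u : SandTree B} : Rw t u → den t = den u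
  | .root h => h.den_eq
  | .or h => by simp only [den, h.den_eq]
  | .and h => by simp only [den, h.den_eq]
  | .sand h => by simp only [den, h.den_eq]
theorem RwL.den_eq {ts us : SandTreeList B} :
    RwL ts us → denOr ts = denOr us ∧ denAnd ts = denAnd us ∧ denSand ts = denSand us
  | .single h => by simp only [denOr, denAnd, denSand, h.den_eq, and_self]
  | .head h => by simp only [denOr, denAnd, denSand, h.den_eq, and_self]
  | .tail h => by simp only [denOr, denAnd, denSand, h.den_eq, and_self]
end

theorem RwStar.den_eq {t u : SandTree B} (h : RwStar t u) : den t = den u := by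
  induction h with
  | refl => rfl
  | tail _ h ih => exact ih.trans (h.elim PEq.den_eq Rw.den_eq)

end Denotation

section Normalization

variable {B : Type}

open SandTreeList SandTree

theorem PEq.rwStar {t u : SandTree B} (h : PEq t u) : RwStar t u := .single (.inl h)

theorem RStep.rwStar {t u : SandTree B} (h : RStep t u) : RwStar t u := .single (.inr (.root h))

/-- Zero or more rewrite steps (modulo commutativity) in the entries of an argument list. -/
def RwStarL : SandTreeList B → SandTreeList B → Prop :=
  Relation.ReflTransGen fun a b => PEqL a b ∨ RwL a b

theorem RwStarL.or {ts us : SandTreeList B} (h : RwStarL ts us) : RwStar (.or ts) (.or us) :=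
  Relation.ReflTransGen.lift _ (fun _ _ h => h.imp .orCongr .or) _ _ h

theorem RwStarL.and {ts us : SandTreeList B} (h : RwStarL ts us) : RwStar (.and ts) (.and us) :=
  Relation.ReflTransGen.lift _ (fun _ _ h => h.imp .andCongr .and) _ _ h

theorem RwStarL.sand {ts us : SandTreeList B} (h : RwStarL ts us) :
    RwStar (.sand ts) (.sand us) :=
  Relation.ReflTransGen.lift _ (fun _ _ h => h.imp .sandCongr .sand) _ _ h

theorem RwStar.single {t u : SandTree B} (h : RwStar t u) : RwStarL (.single t) (.single u) :=
  Relation.ReflTransGen.lift _ (fun _ _ h => h.imp .single .single) _ _ h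

theorem RwStar.head {t u : SandTree B} (ts : SandTreeList B) (h : RwStar t u) :
    RwStarL (.cons t ts) (.cons u ts) :=
  Relation.ReflTransGen.lift (SandTreeList.cons · ts)
    (fun _ _ h => h.imp (.cons · (.refl ts)) .head) _ _ h

theorem RwStarL.tail (t : SandTree B) {ts us : SandTreeList B} (h : RwStarL ts us) :
    RwStarL (.cons t ts) (.cons t us) :=
  Relation.ReflTransGen.lift _ (fun _ _ h => h.imp (.cons (.refl t)) .tail) _ _ h

theorem RwStarL.glue (xs : List (SandTree B)) {ts us : SandTreeList B} (h : RwStarL ts us) :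
    RwStarL (glue xs ts) (glue xs us) := by
  induction xs with
  | nil => exact h
  | cons x xs ih => exact ih.tail x

theorem RwStarL.map {f g : SandTree B → SandTree B} (h : ∀ t, RwStar (f t) (g t)) :
    ∀ ts : SandTreeList B, RwStarL (ts.map f) (ts.map g)
  | .single t => (h t).single
  | .cons t ts => ((h t).head _).trans ((RwStarL.map h ts).tail _)

theorem RwStar.or_flatten (xs : List (SandTree B)) (ys : SandTreeList B)
    (zs : List (SandTree B)) :
    RwStar (.or (glue xs (snoc (.single (.or ys)) zs))) (.or (glue xs (snoc ys zs))) := by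
  refine (PEq.orPerm ?_).rwStar.trans ((RStep.r3 (xs ++ zs) ys).rwStar.trans
    (PEq.orPerm ?_).rwStar)
  · simpa using (List.perm_append_comm (l₁ := [SandTree.or ys])).append_left xs
  · simpa using (List.perm_append_comm (l₁ := zs)).append_left xs

theorem RwStar.and_flatten (xs : List (SandTree B)) (ys : SandTreeList B)
    (zs : List (SandTree B)) :
    RwStar (.and (glue xs (snoc (.single (.and ys)) zs))) (.and (glue xs (snoc ys zs))) := by
  refine (PEq.andPerm ?_).rwStar.trans ((RStep.r4 (xs ++ zs) ys).rwStar.trans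
    (PEq.andPerm ?_).rwStar)
  · simpa using (List.perm_append_comm (l₁ := [SandTree.and ys])).append_left xs
  · simpa using (List.perm_append_comm (l₁ := zs)).append_left xs

theorem RwStar.and_distrib (xs : List (SandTree B)) (ys : SandTreeList B)
    (zs : List (SandTree B)) :
    RwStar (.and (glue xs (snoc (.single (.or ys)) zs)))
      (.or (ys.map fun y => .and (glue xs (snoc (.single y) zs)))) := by
  refine (PEq.andPerm ?_).rwStar.trans ((RStep.r10 (xs ++ zs) ys).rwStar.trans
    (PEq.orCongr (PEqL.map (fun y => .andPerm ?_) ys)).rwStar)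
  · simpa using (List.perm_append_comm (l₁ := [SandTree.or ys])).append_left xs
  · simpa using (List.perm_append_comm (l₁ := zs) (l₂ := [y])).append_left xs

/-- The disjunction of a nonempty list of trees, where a single tree is left as it is. -/
def SandTreeList.mkOr : SandTreeList B → SandTree B
  | .single t => t
  | .cons t ts => .or (.cons t ts)

theorem SandTreeList.mkOr_eq_or {ts : SandTreeList B} (h : 2 ≤ ts.toList.length) :
    ts.mkOr = .or ts := by
  cases ts with
  | single t => simp at h
  | cons t ts => rfl

theorem PEq.mkOr {ts us : SandTreeList B} (h : ts.toList.Perm us.toList) :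
    PEq ts.mkOr us.mkOr := by
  by_cases hl : 2 ≤ ts.toList.length
  · rw [mkOr_eq_or hl, mkOr_eq_or (h.length_eq ▸ hl)]
    exact .orPerm h
  · cases ts with
    | single t =>
      obtain rfl : us = .single t := toList_injective (by simpa using h.symm)
      exact .refl _
    | cons t ts => cases ts <;> simp at hl

theorem RwStar.mkOr (ts : SandTreeList B) : RwStar (.or ts) ts.mkOr := by
  cases ts with
  | single t => exact (RStep.r5 t).rwStar
  | cons t ts => exact .refl

theorem RwStar.or_glue_mkOr (xs : List (SandTree B)) (ys : SandTreeList B)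
    (zs : List (SandTree B)) :
    RwStar (.or (glue xs (snoc (.single ys.mkOr) zs))) (.or (glue xs (snoc ys zs))) := by
  cases ys with
  | single y => exact .refl
  | cons y ys => exact RwStar.or_flatten xs _ zs

theorem RwStar.mkOr_map {f g : SandTree B → SandTree B} (h : ∀ t, RwStar (f t) (g t))
    (ts : SandTreeList B) : RwStar (ts.map f).mkOr (ts.map g).mkOr := by
  cases ts with
  | single t => exact h t
  | cons t ts => exact (RwStarL.map h (.cons t ts)).or

theorem RwStar.mkOr_map_mkOr (f : SandTree B → SandTreeList B) (ts : SandTreeList B) :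
    RwStar (ts.map fun t => (f t).mkOr).mkOr (bind f ts).mkOr := by
  have key (ts : SandTreeList B) : ∀ xs : List (SandTree B),
      RwStar (.or (SandTreeList.glue xs (ts.map fun t => (f t).mkOr)))
        (.or (SandTreeList.glue xs (bind f ts))) := by
    induction ts using SandTreeList.rec (motive_1 := fun _ => True) with
    | single t _ =>
      intro xs
      simpa only [snoc_nil, SandTreeList.map, SandTreeList.bind] using
        RwStar.or_glue_mkOr xs (f t) []
    | cons t ts _ ih =>
      intro xs
      have h₁ : SandTreeList.glue xs (SandTreeList.map (fun t => (f t).mkOr) (.cons t ts)) =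
          SandTreeList.glue xs
            (snoc (.single (f t).mkOr) (ts.map fun t => (f t).mkOr).toList) :=
        toList_injective (by simp)
      have h₂ : SandTreeList.glue xs (snoc (f t) (ts.map fun t => (f t).mkOr).toList) =
          SandTreeList.glue (xs ++ (f t).toList) (ts.map fun t => (f t).mkOr) :=
        toList_injective (by simp)
      have h₃ : SandTreeList.glue (xs ++ (f t).toList) (bind f ts) =
          SandTreeList.glue xs (bind f (.cons t ts)) :=
        toList_injective (by simp)
      rw [h₁, ← h₃]
      exact (RwStar.or_glue_mkOr _ _ _).trans (h₂ ▸ ih _)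
    | _ => trivial
  cases ts with
  | single t => exact .refl
  | cons t ts => exact (key (.cons t ts) []).trans (RwStar.mkOr _)

/-- The classes of the entries of an argument list. -/
def SandTreeList.classes (ts : SandTreeList B) : Set (TreeClass B) :=
  TreeClass.mk '' {t | t ∈ ts.toList}

/-- A tree is reducible to the disjunction of its flattened disjuncts. -/
def RwToDen (t : SandTree B) : Prop :=
  ∃ L : SandTreeList B, L.classes = den t ∧ RwStar t L.mkOr

/-- The rewriting properties shared by `AND` and `SAND`. -/
structure IsConjunction (op : SandTreeList B → SandTree B)
    (args : SandTree B → SandTreeList B) : Prop where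
  congr {ts us : SandTreeList B} : RwStarL ts us → RwStar (op ts) (op us)
  args_op (ts : SandTreeList B) : args (op ts) = ts
  distrib (xs : List (SandTree B)) (ys : SandTreeList B) (zs : List (SandTree B)) :
    RwStar (op (glue xs (snoc (.single (.or ys)) zs)))
      (.or (ys.map fun y => op (glue xs (snoc (.single y) zs))))
  flatten (xs : List (SandTree B)) (t : SandTree B) (zs : List (SandTree B)) :
    RwStar (op (glue xs (snoc (.single t) zs))) (op (glue xs (snoc (args t) zs)))
  op_args (t : SandTree B) : RwStar (op (args t)) t

theorem isConjunction_and : IsConjunction (B := B) .and andArgs where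
  congr := RwStarL.and
  args_op _ := rfl
  distrib := RwStar.and_distrib
  flatten xs t zs := by
    cases t with
    | and ts => exact RwStar.and_flatten xs ts zs
    | _ => exact .refl
  op_args t := by
    cases t with
    | and ts => exact .refl
    | _ => exact (RStep.r6 _).rwStar

theorem isConjunction_sand : IsConjunction (B := B) .sand sandArgs where
  congr := RwStarL.sand
  args_op _ := rfl
  distrib xs ys zs := (RStep.r10' xs ys zs).rwStar
  flatten xs t zs := by
    cases t with
    | sand ts => exact (RStep.r4' xs ts zs).rwStar
    | _ => exact .refl
  op_args t := by
    cases t with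
    | sand ts => exact .refl
    | _ => exact (RStep.r6' _).rwStar

namespace IsConjunction

variable {op : SandTreeList B → SandTree B} {args : SandTree B → SandTreeList B}

theorem distrib_flatten (hop : IsConjunction op args) (xs : List (SandTree B))
    {t : SandTree B} {L : SandTreeList B} (h : RwStar t L.mkOr) (zs : List (SandTree B)) :
    RwStar (op (glue xs (snoc (.single t) zs)))
      (L.map fun y => op (glue xs (snoc (args y) zs))).mkOr := by
  have hc : RwStarL (glue xs (snoc (.single t) zs)) (glue xs (snoc (.single L.mkOr) zs)) := by
    cases zs with
    | nil => exact h.single.glue xs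
    | cons z zs => exact (h.head _).glue xs
  refine (hop.congr hc).trans (.trans ?_ (RwStar.mkOr_map (fun y => hop.flatten xs y zs) L))
  cases L with
  | single y => exact .refl
  | cons y L => exact hop.distrib xs _ zs

theorem exists_rwStar_or_map (hop : IsConjunction op args)
    {m : TreeClass B → TreeClass B → TreeClass B}
    (hm : ∀ t u, m (.mk t) (.mk u) = .mk (op (snoc (args t) (args u).toList)))
    {F : SandTreeList B → Set (TreeClass B)} (single : ∀ t, F (.single t) = den t)
    (cons : ∀ t ts, F (.cons t ts) = Set.image2 m (den t) (F ts)) :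
    ∀ ts : SandTreeList B, (∀ t ∈ ts.toList, RwToDen t) → ∀ xs : List (SandTree B),
      ∃ L : SandTreeList B, L.classes = F ts ∧
        RwStar (op (glue xs ts)) (L.map fun a => op (glue xs (args a))).mkOr
  | .single t, h, xs => by
      obtain ⟨L, hL, hr⟩ := h t (by simp)
      refine ⟨L, by rw [hL, single], ?_⟩
      simpa only [snoc_nil] using hop.distrib_flatten xs hr []
  | .cons t ts, h, xs => by
      obtain ⟨L, hL, hr⟩ := h t (by simp)
      obtain ⟨M, hM, hrM⟩ := hop.exists_rwStar_or_map hm single cons ts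
        (fun u hu => h u (by simp [hu])) (xs ++ [t])
      refine ⟨bind (fun a => L.map fun y => op (snoc (args y) (args a).toList)) M, ?_, ?_⟩
      · rw [cons, ← hL, ← hM]
        ext q
        simp only [classes, Set.mem_image, Set.mem_ofPred_eq, toList_bind, toList_map,
          List.mem_flatMap, List.mem_map, Set.mem_image2, exists_exists_and_eq_and, hm]
        constructor
        · rintro ⟨_, ⟨a, ha, y, hy, rfl⟩, rfl⟩
          exact ⟨y, hy, a, ha, rfl⟩
        · rintro ⟨y, hy, a, ha, rfl⟩
          exact ⟨_, ⟨a, ha, y, hy, rfl⟩, rfl⟩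
      · have h₁ : glue (xs ++ [t]) ts = glue xs (.cons t ts) := toList_injective (by simp)
        have h₂ (a : SandTree B) :
            glue (xs ++ [t]) (args a) = glue xs (snoc (.single t) (args a).toList) :=
          toList_injective (by simp)
        rw [h₁] at hrM
        refine hrM.trans ?_
        simp only [map_bind, map_map, hop.args_op, h₂]
        exact (RwStar.mkOr_map (fun a => hop.distrib_flatten xs hr (args a).toList) M).trans
          (RwStar.mkOr_map_mkOr _ M)

theorem exists_rwStar_or (hop : IsConjunction op args)
    {m : TreeClass B → TreeClass B → TreeClass B}
    (hm : ∀ t u, m (.mk t) (.mk u) = .mk (op (snoc (args t) (args u).toList)))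
    {F : SandTreeList B → Set (TreeClass B)} (single : ∀ t, F (.single t) = den t)
    (cons : ∀ t ts, F (.cons t ts) = Set.image2 m (den t) (F ts))
    {ts : SandTreeList B} (h : ∀ t ∈ ts.toList, RwToDen t) :
    ∃ L : SandTreeList B, L.classes = F ts ∧ RwStar (op ts) L.mkOr := by
  obtain ⟨L, hL, hr⟩ := hop.exists_rwStar_or_map hm single cons ts h []
  have hid : L.map (fun a => a) = L := toList_injective (by simp)
  refine ⟨L, hL, hr.trans ?_⟩
  have h := RwStar.mkOr_map hop.op_args L
  rwa [hid] at h

end IsConjunction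

theorem exists_rwStar_or_glue : ∀ ts : SandTreeList B, (∀ t ∈ ts.toList, RwToDen t) →
    ∀ xs : List (SandTree B), ∃ L : SandTreeList B, L.classes = denOr ts ∧
      RwStar (.or (glue xs ts)) (.or (glue xs L))
  | .single t, h, xs => by
      obtain ⟨L, hL, hr⟩ := h t (by simp)
      refine ⟨L, by rw [hL, denOr], (hr.single.glue xs).or.trans ?_⟩
      have := RwStar.or_glue_mkOr xs L []
      rwa [snoc_nil, snoc_nil] at this
  | .cons t ts, h, xs => by
      obtain ⟨L, hL, hr⟩ := h t (by simp)
      obtain ⟨M, hM, hrM⟩ := exists_rwStar_or_glue ts (fun u hu => h u (by simp [hu]))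
        (xs ++ L.toList)
      refine ⟨glue L.toList M, ?_, ((hr.head ts).glue xs).or.trans ?_⟩
      · rw [denOr, ← hL, ← hM]
        simp [classes, Set.ofPred_or, Set.image_union]
      · have h₁ : glue xs (.cons L.mkOr ts) = glue xs (snoc (.single L.mkOr) ts.toList) :=
          toList_injective (by simp)
        have h₂ : glue xs (snoc L ts.toList) = glue (xs ++ L.toList) ts :=
          toList_injective (by simp)
        have h₃ : glue (xs ++ L.toList) M = glue xs (glue L.toList M) :=
          toList_injective (by simp)
        rw [h₁, ← h₃]
        exact (RwStar.or_glue_mkOr _ _ _).trans (h₂ ▸ hrM)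

mutual
theorem rwToDen : ∀ t : SandTree B, RwToDen t
  | .atom b =>
      ⟨.single (.atom b), by simp [classes, den], .refl⟩
  | .or ts =>
      let ⟨L, hL, hr⟩ := exists_rwStar_or_glue ts (rwToDen_of_mem ts) []
      ⟨L, hL, hr.trans (RwStar.mkOr L)⟩
  | .and ts => isConjunction_and.exists_rwStar_or (fun _ _ => rfl) (fun _ => by rw [denAnd])
      (fun _ _ => by rw [denAnd]) (rwToDen_of_mem ts)
  | .sand ts => isConjunction_sand.exists_rwStar_or (fun _ _ => rfl) (fun _ => by rw [denSand])
      (fun _ _ => by rw [denSand]) (rwToDen_of_mem ts)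
theorem rwToDen_of_mem : ∀ ts : SandTreeList B, ∀ t ∈ ts.toList, RwToDen t
  | .single t, u, h => by
      have ht := rwToDen t
      rwa [List.mem_singleton.1 h]
  | .cons t ts, u, h => by
      have ht := rwToDen t
      have hts := rwToDen_of_mem ts
      rcases List.mem_cons.1 h with rfl | h
      · exact ht
      · exact hts u h
end

theorem exists_rwStar_mkOr_nodup (ts : SandTreeList B) : ∃ us : SandTreeList B,
    RwStar ts.mkOr us.mkOr ∧ us.toList.Nodup ∧ ∀ t, t ∈ us.toList ↔ t ∈ ts.toList := by
  by_cases hn : ts.toList.Nodup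
  · exact ⟨ts, .refl, hn, fun _ => .rfl⟩
  · obtain ⟨a, ha⟩ := List.exists_duplicate_iff_not_nodup.2 hn
    obtain ⟨l, hl⟩ := (List.duplicate_iff_sublist.1 ha).exists_perm_append
    obtain ⟨us, hr, hus, hmem⟩ := exists_rwStar_mkOr_nodup (ofList a l)
    refine ⟨us, ?_, hus, fun t => by simp [hmem, hl.mem_iff]⟩
    have hp : ts.toList.Perm (SandTreeList.cons a (ofList a l)).toList := by simpa using hl
    exact (PEq.mkOr hp).rwStar.trans ((RStep.r11 a l).rwStar.trans ((RwStar.mkOr _).trans hr))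
termination_by ts.toList.length
decreasing_by simp [hl.length_eq]

theorem RwStar.join_mkOr {ts us : SandTreeList B} (h : ts.classes = us.classes) :
    ∃ t, RwStar ts.mkOr t ∧ RwStar us.mkOr t := by
  let rep : SandTree B → SandTree B := fun t => (TreeClass.mk t).out
  have hrep (t : SandTree B) : RwStar t (rep t) :=
    (TreeClass.mk_eq_mk.1 (Quotient.out_eq (TreeClass.mk t)).symm).rwStar
  have hmap (ts : SandTreeList B) : RwStar ts.mkOr (ts.map rep).mkOr := by
    have hid : ts.map (fun t => t) = ts := toList_injective (by simp)
    simpa only [hid] using RwStar.mkOr_map hrep ts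
  have hmem (ts : SandTreeList B) (t : SandTree B) :
      t ∈ (ts.map rep).toList ↔ ∃ q ∈ ts.classes, q.out = t := by
    simp [classes, rep]
  obtain ⟨ts', hts, hnd, hm⟩ := exists_rwStar_mkOr_nodup (ts.map rep)
  obtain ⟨us', hus, hnd', hm'⟩ := exists_rwStar_mkOr_nodup (us.map rep)
  have hperm : ts'.toList.Perm us'.toList :=
    (List.perm_ext_iff_of_nodup hnd hnd').2 fun t => by rw [hm, hm', hmem, hmem, h]
  exact ⟨us'.mkOr, (hmap ts).trans (hts.trans (PEq.mkOr hperm).rwStar), (hmap us).trans hus⟩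

end Normalization

/-- Theorem 2: the term rewriting system `⇒` (modulo
commutativity of `OR` and `AND`) is strongly terminating and confluent. -/
theorem rw_terminating_confluent (B : Type) :
    (∀ f : ℕ → SandTree B, ¬ ∀ n : ℕ, RwMod (f n) (f (n + 1))) ∧
    (∀ t t1 t2 : SandTree B, RwStar t t1 → RwStar t t2 →
      ∃ t3 : SandTree B, RwStar t1 t3 ∧ RwStar t2 t3) := by
  refine ⟨fun f hf => ?_, fun t t1 t2 h1 h2 => ?_⟩
  · exact not_strictAnti_of_wellFoundedLT (fun n => weight (f n))
      (strictAnti_nat_of_succ_lt fun n => (hf n).weight_lt)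
  · obtain ⟨L, hL, hr⟩ := rwToDen t1
    obtain ⟨M, hM, hs⟩ := rwToDen t2
    obtain ⟨t3, h3, h4⟩ := RwStar.join_mkOr (hL.trans (h1.den_eq.symm.trans
      (h2.den_eq.trans hM.symm)))
    exact ⟨t3, hr.trans h3, hs.trans h4⟩
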